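/- arXiv:2307.15383 — 4 statements merged into one kernel-verified Lean document; each statement's English description precedes it below -/
import Mathlib

section
/- Let T₀ <lex T₁ <lex … <lex T_{n−1} (n ≥ 2) be pairwise distinct lists over a linearly ordered type U, listed in strictly increasing lexicographic order, and let S = {T₀, …, T_{n−1}}. Then the set of longest shared prefixes of S equals the set of longest common prefixes of lexicographically consecutive elements: { lcp(Tₐ, T_b) : 0 ≤ a < b ≤ n−1 } = { lcp(Tᵢ, T_{i+1}) : 0 ≤ i ≤ n−2 }. -/
/-- The longest common prefix of two lists: the longest list that is a prefix of both. -/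
def lcp {U : Type*} [DecidableEq U] : List U → List U → List U
  | a :: as, b :: bs => if a = b then a :: lcp as bs else []
  | _, _ => []

/-- For lexicographically sorted `a < b < c`, the longest common prefix of the outer two lists
is attained by one of the two adjacent pairs. -/
theorem lcp_eq_or_eq_of_lt_of_lt {U : Type*} [LinearOrder U] {a b c : List U}
    (hab : a < b) (hbc : b < c) : lcp a c = lcp a b ∨ lcp a c = lcp b c := by
  induction a generalizing b c with
  | nil => left; simp [lcp]
  | cons x a ih =>
    cases b with
    | nil => simp at hab
    | cons y b =>
      cases c with
      | nil => simp at hbc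
      | cons z c =>
        rw [List.cons_lt_cons_iff] at hab hbc
        rcases hab with hxy | ⟨rfl, hab⟩
        · have hxz : x ≠ z := by
            rcases hbc with hyz | ⟨rfl, -⟩
            exacts [(hxy.trans hyz).ne, hxy.ne]
          left
          simp [lcp, hxy.ne, hxz]
        · rcases hbc with hxz | ⟨rfl, hbc⟩
          · right
            simp [lcp, hxz.ne]
          · simpa [lcp] using ih hab hbc

/-- In a strictly increasing sequence of lists, the longest common prefix of any two terms is
the longest common prefix of two consecutive terms. -/
theorem exists_lcp_eq_lcp_succ {U : Type*} [LinearOrder U] {n : ℕ}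
    {T : Fin n → List U} (hmono : ∀ i j : Fin n, i < j → T i < T j) (a : Fin n) {b : ℕ}
    (hab : (a : ℕ) + 1 ≤ b) (hb : b < n) :
    ∃ i : Fin n, ∃ h : (i : ℕ) + 1 < n, lcp (T a) (T ⟨b, hb⟩) = lcp (T i) (T ⟨(i : ℕ) + 1, h⟩) := by
  induction b, hab using Nat.le_induction with
  | base => exact ⟨a, hb, rfl⟩
  | succ b hab ih =>
    have hb' : b < n := by omega
    rcases lcp_eq_or_eq_of_lt_of_lt (hmono a ⟨b, hb'⟩ (Fin.lt_def.2 hab))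
      (hmono ⟨b, hb'⟩ ⟨b + 1, hb⟩ (Fin.lt_def.2 b.lt_succ_self)) with h | h
    · rw [h]
      exact ih hb'
    · exact ⟨⟨b, hb'⟩, hb, h⟩

/-- If `T₀ <lex T₁ <lex … <lex T_{n−1}` (with `n ≥ 2`) are pairwise distinct
lists over a linearly ordered type `U` in strictly increasing lexicographic order, then
the set of longest shared prefixes of `S = {T₀, …, T_{n−1}}` equals the set of longest
common prefixes of lexicographically consecutive elements. -/
theorem stmt6 {U : Type*} [LinearOrder U] (n : ℕ) (hn : 2 ≤ n)
    (T : Fin n → List U) (hmono : ∀ i j : Fin n, i < j → T i < T j) :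
    {p : List U | ∃ a b : Fin n, a < b ∧ p = lcp (T a) (T b)}
      = {p : List U | ∃ i : Fin n, ∃ h : (i : ℕ) + 1 < n,
          p = lcp (T i) (T ⟨(i : ℕ) + 1, h⟩)} := by
  ext p
  constructor
  · rintro ⟨a, b, hab, rfl⟩
    exact exists_lcp_eq_lcp_succ hmono a hab b.isLt
  · rintro ⟨i, h, rfl⟩
    exact ⟨i, ⟨i + 1, h⟩, Fin.lt_def.2 (Nat.lt_succ_self i), rfl⟩
end

section
/- Let Tₐ, T, T_b be lists over a linearly ordered type U with Tₐ ≤lex T ≤lex T_b in the lexicographic order. Then lcp(Tₐ, T_b) is a prefix of T; consequently lcp(Tₐ, T_b) is a prefix of both lcp(Tₐ, T) and lcp(T, T_b). -/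
theorem lcp_prefix_left {U : Type*} [DecidableEq U] (a b : List U) : lcp a b <+: a := by
  induction a generalizing b with
  | nil => simp [lcp]
  | cons x a ih =>
    cases b with
    | nil => simp [lcp]
    | cons y b =>
      by_cases h : x = y <;> simp [lcp, h, ih]

theorem lcp_prefix_right {U : Type*} [DecidableEq U] (a b : List U) : lcp a b <+: b := by
  induction a generalizing b with
  | nil => simp [lcp]
  | cons x a ih =>
    cases b with
    | nil => simp [lcp]
    | cons y b =>
      by_cases h : x = y <;> simp [lcp, h, ih]

theorem prefix_lcp {U : Type*} [DecidableEq U] {p a b : List U} (ha : p <+: a) (hb : p <+: b) :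
    p <+: lcp a b := by
  induction p generalizing a b with
  | nil => simp
  | cons x p ih =>
    obtain ⟨s, rfl⟩ := ha
    obtain ⟨t, rfl⟩ := hb
    simpa [lcp] using ih (List.prefix_append p s) (List.prefix_append p t)

theorem lcp_prefix_of_le_of_le {U : Type*} [LinearOrder U] {a t b : List U}
    (hat : a ≤ t) (htb : t ≤ b) : lcp a b <+: t := by
  induction a generalizing t b with
  | nil => simp [lcp]
  | cons x a ih =>
    cases b with
    | nil => simp [lcp]
    | cons y b =>
      by_cases h : x = y
      · subst h
        cases t with
        | nil => exact absurd (List.nil_lt_cons x a) (not_lt.mpr hat)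
        | cons z t =>
          rw [← not_lt, List.not_lt, List.cons_le_cons_iff, ← List.not_lt, not_lt] at hat htb
          rcases hat with hxz | ⟨rfl, hat⟩
          · rcases htb with hzx | ⟨rfl, -⟩
            · exact absurd hzx hxz.asymm
            · exact absurd hxz (lt_irrefl _)
          · rcases htb with hxx | ⟨-, htb⟩
            · exact absurd hxx (lt_irrefl _)
            · simpa [lcp] using ih hat htb
      · simp [lcp, h]

/-- If `Tₐ ≤lex T ≤lex T_b` (lexicographic order on lists over a linearly
ordered type), then `lcp Tₐ T_b` is a prefix of `T`; consequently it is a prefix of both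
`lcp Tₐ T` and `lcp T T_b`. -/
theorem stmt7 {U : Type*} [LinearOrder U] (Ta T Tb : List U)
    (h1 : Ta ≤ T) (h2 : T ≤ Tb) :
    lcp Ta Tb <+: T ∧ lcp Ta Tb <+: lcp Ta T ∧ lcp Ta Tb <+: lcp T Tb := by
  have h := lcp_prefix_of_le_of_le h1 h2
  exact ⟨h, prefix_lcp (lcp_prefix_left Ta Tb) h, prefix_lcp h (lcp_prefix_right Ta Tb)⟩
end

section
/- Let S be a finite set of pairwise distinct lists over a linearly ordered type U with |S| = n ≥ 2. Then S has at most n − 1 distinct longest shared prefixes, i.e., the cardinality of the set { lcp(Tₐ, T_b) : Tₐ, T_b ∈ S, Tₐ ≠ T_b } is at most n − 1. -/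
theorem lcp_comm {U : Type*} [DecidableEq U] (a b : List U) : lcp a b = lcp b a := by
  induction a generalizing b with
  | nil => cases b <;> simp [lcp]
  | cons x a ih => cases b <;> grind [lcp]

theorem lcp_eq_of_length_eq {U : Type*} [DecidableEq U] {x b c : List U}
    (h : (lcp x c).length = (lcp x b).length) : lcp x c = lcp x b :=
  (List.prefix_of_prefix_length_le (lcp_prefix_left x c) (lcp_prefix_left x b) h.le).eq_of_length h

theorem lcp_eq_of_length_lt {U : Type*} [DecidableEq U] {x b c : List U}
    (h : (lcp x c).length < (lcp x b).length) : lcp x c = lcp b c := by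
  induction x generalizing b c with
  | nil => cases b <;> simp [lcp] at h
  | cons u x ih => cases b <;> cases c <;> grind [lcp]

/-- The set of longest shared prefixes of a finite set of lists. -/
def sharedPrefixes {U : Type*} [DecidableEq U] (S : Finset (List U)) : Set (List U) :=
  {p | ∃ a ∈ S, ∃ b ∈ S, a ≠ b ∧ p = lcp a b}

/-- Adding a list to a nonempty set creates at most one new longest shared prefix. -/
theorem exists_sharedPrefixes_cons_subset {U : Type*} [DecidableEq U] {T : Finset (List U)}
    (hT : T.Nonempty) (x : List U) (hx : x ∉ T) :
    ∃ p, sharedPrefixes (T.cons x hx) ⊆ insert p (sharedPrefixes T) := by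
  obtain ⟨b, hb, hmax⟩ := T.exists_max_image (fun c => (lcp x c).length) hT
  have key : ∀ c ∈ T, lcp x c ∈ insert (lcp x b) (sharedPrefixes T) := by
    intro c hc
    rcases (hmax c hc).eq_or_lt with h | h
    · exact Or.inl (lcp_eq_of_length_eq h)
    · refine Or.inr ⟨b, hb, c, hc, ?_, lcp_eq_of_length_lt h⟩
      rintro rfl
      exact h.false
  refine ⟨lcp x b, ?_⟩
  rintro _ ⟨a, ha, c, hc, hac, rfl⟩
  rcases Finset.mem_cons.1 ha with rfl | haT <;> rcases Finset.mem_cons.1 hc with rfl | hcT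
  · exact absurd rfl hac
  · exact key c hcT
  · exact lcp_comm a c ▸ key a haT
  · exact Or.inr ⟨a, haT, c, hcT, hac, rfl⟩

theorem encard_sharedPrefixes_add_one_le {U : Type*} [DecidableEq U] {S : Finset (List U)}
    (hS : S.Nonempty) : (sharedPrefixes S).encard + 1 ≤ S.card := by
  induction hS using Finset.Nonempty.cons_induction with
  | singleton a =>
    have h : sharedPrefixes {a} = ∅ := by
      ext p
      simp [sharedPrefixes]
    simp [h]
  | cons x T hx hT ih =>
    obtain ⟨p, hp⟩ := exists_sharedPrefixes_cons_subset hT x hx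
    rw [Finset.card_cons, Nat.cast_add, Nat.cast_one]
    gcongr
    exact (Set.encard_le_encard hp).trans ((Set.encard_insert_le _ _).trans ih)

/-- A finite set `S` of pairwise distinct lists over a linearly ordered type
with `|S| = n ≥ 2` has at most `n − 1` distinct longest shared prefixes. -/
theorem stmt9 {U : Type*} [LinearOrder U] (S : Finset (List U)) (hS : 2 ≤ S.card) :
    {p : List U | ∃ a ∈ S, ∃ b ∈ S, a ≠ b ∧ p = lcp a b}.ncard ≤ S.card - 1 := by
  have h := encard_sharedPrefixes_add_one_le (Finset.card_pos.1 (by omega : 0 < S.card))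
  have hfin : (sharedPrefixes S).Finite := by
    refine Set.finite_of_encard_le_coe (k := S.card) (le_trans ?_ h)
    exact le_self_add
  rw [← hfin.cast_ncard_eq] at h
  have h' : (sharedPrefixes S).ncard + 1 ≤ S.card := by exact_mod_cast h
  exact Nat.le_sub_of_add_le h'
end

section
/- Let S be a finite set of pairwise distinct lists over a linearly ordered type U with |S| ≥ 2, and let r = lcp(T_min, T_max) where T_min and T_max are the lexicographically least and greatest elements of S. Then r is a longest shared prefix of S, r is a prefix of every element of S, and r is a prefix of every longest shared prefix of S (so the prefix forest of LSPs of S is a tree rooted at r). -/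
/-- The analogue of `List.cons_le_cons_iff` for Mathlib's linear order on lists, whose `≤` is not
syntactically the one from core. -/
theorem cons_le_cons_iff_lex {U : Type*} [LinearOrder U] {x y : U} {a b : List U} :
    x :: a ≤ y :: b ↔ x < y ∨ x = y ∧ a ≤ b := by
  have h : x :: a < y :: b ↔ x < y ∨ x = y ∧ a < b := List.cons_lt_cons_iff
  rw [le_iff_lt_or_eq, h, List.cons.injEq, le_iff_lt_or_eq]
  tauto

/-- Let `S` be a finite set of pairwise distinct lists over a linearly
ordered type with `|S| ≥ 2`, and let `r = lcp T_min T_max` where `T_min`, `T_max` are the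
lexicographically least and greatest elements of `S`. Then `r` is a longest shared prefix
of `S`, `r` is a prefix of every element of `S`, and `r` is a prefix of every longest
shared prefix of `S` (so the prefix forest of LSPs of `S` is a tree rooted at `r`). -/
theorem stmt10 {U : Type*} [LinearOrder U] (S : Finset (List U)) (hS : 2 ≤ S.card)
    (hne : S.Nonempty) :
    (∃ a ∈ S, ∃ b ∈ S, a ≠ b ∧ lcp (S.min' hne) (S.max' hne) = lcp a b) ∧
    (∀ T ∈ S, lcp (S.min' hne) (S.max' hne) <+: T) ∧
    (∀ p : List U, (∃ a ∈ S, ∃ b ∈ S, a ≠ b ∧ p = lcp a b) →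
      lcp (S.min' hne) (S.max' hne) <+: p) := by
  have hprefix : ∀ T ∈ S, lcp (S.min' hne) (S.max' hne) <+: T := fun T hT =>
    lcp_prefix_of_le_of_le (S.min'_le T hT) (S.le_max' T hT)
  refine ⟨⟨S.min' hne, S.min'_mem hne, S.max' hne, S.max'_mem hne, ?_, rfl⟩, hprefix, ?_⟩
  · exact (S.min'_lt_max'_of_card hS).ne
  · rintro p ⟨a, ha, b, hb, -, rfl⟩
    exact prefix_lcp (hprefix a ha) (hprefix b hb)
end
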